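/- Let G be a finite group and M = S₁ × ⋯ × Sₙ a normal subgroup of G which is a direct product of non-abelian simple groups Sᵢ, permuted by conjugation by G. For each i let δᵢ ∈ Irr(Sᵢ) be such that δᵢ^g = δⱼ whenever Sᵢ^{g⁻¹} = Sⱼ for g ∈ G, and suppose each δᵢ extends to the full automorphism group Aut(Sᵢ) (after identifying Sᵢ with its inner automorphisms). Then the irreducible character δ = δ₁ × ⋯ × δₙ of M extends to an irreducible character of G. -/

import Mathlib

open CategoryTheory

/-- Simplicity of a representation can be tested on a pullback. -/
theorem simple_of_res_simple {G P : Type} [Group G] [Finite G] [Group P] [Finite P]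
    (f : P →* G) (X : FDRep ℂ G) (h : Simple ((Action.res _ f).obj X : FDRep ℂ P)) :
    Simple X := by
  have : NeZero (Nat.card G : ℂ) := ⟨by exact_mod_cast Nat.card_pos.ne'⟩
  have : NeZero (Nat.card P : ℂ) := ⟨by exact_mod_cast Nat.card_pos.ne'⟩
  rw [FDRep.simple_iff_end_is_rank_one]
  have h1 := (FDRep.simple_iff_end_is_rank_one _).1 h
  have hle : Module.finrank ℂ (X ⟶ X) ≤ 1 := by
    rw [← h1]
    exact LinearMap.finrank_le_finrank_of_injective
      (f := (Action.res (FGModuleCat ℂ) f).mapLinearMap ℂ (X := X) (Y := X))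
      ((Action.res (FGModuleCat ℂ) f).map_injective)
  have hpos : 0 < Module.finrank ℂ (X ⟶ X) := by
    rw [Module.finrank_pos_iff_exists_ne_zero]
    refine ⟨𝟙 X, fun h0 => ?_⟩
    apply id_nonzero ((Action.res _ f).obj X : FDRep ℂ P)
    rw [← (Action.res (FGModuleCat ℂ) f).map_id, h0]
    exact (Action.res (FGModuleCat ℂ) f).map_zero X X
  omega

/-- Tensor induction, in matrix form. -/
noncomputable def tensorHom {G ι : Type} [Group G] [Fintype ι] [DecidableEq ι] [MulAction G ι]
    (n : ι → ℕ) (T : ∀ i j : ι, G → Matrix (Fin (n i)) (Fin (n j)) ℂ)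
    (hone : ∀ i, T i i 1 = 1)
    (hmul : ∀ (g h : G) (j : ι), T (g • h • j) (h • j) g * T (h • j) j h = T (g • h • j) j (g * h)) :
    G →* Matrix (∀ i, Fin (n i)) (∀ i, Fin (n i)) ℂ where
  toFun g := Matrix.of fun p q => ∏ j, T (g • j) j g (p (g • j)) (q j)
  map_one' := by
    ext p q
    have : ∀ j, T ((1 : G) • j) j 1 (p ((1 : G) • j)) (q j) = T j j 1 (p j) (q j) := by
      intro j
      rw [one_smul]
    simp only [Matrix.of_apply, this, hone, Matrix.one_apply]
    by_cases hpq : p = q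
    · simp [hpq]
    · rw [if_neg hpq]
      obtain ⟨j, hj⟩ := Function.ne_iff.1 hpq
      exact Finset.prod_eq_zero (Finset.mem_univ j) (if_neg hj)
  map_mul' g h := by
    ext p r
    rw [Matrix.mul_apply]
    simp only [Matrix.of_apply]
    have e1 : ∀ q : (∀ i, Fin (n i)), (∏ j, T (h • j) j h (q (h • j)) (r j)) =
        ∏ k, T k (h⁻¹ • k) h (q k) (r (h⁻¹ • k)) := by
      intro q
      rw [← Equiv.prod_comp (MulAction.toPerm h)
        (fun k => T k (h⁻¹ • k) h (q k) (r (h⁻¹ • k)))]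
      refine Finset.prod_congr rfl fun j _ => ?_
      change _ = T (h • j) (h⁻¹ • h • j) h (q (h • j)) (r (h⁻¹ • h • j))
      rw [inv_smul_smul]
    simp only [e1, ← Finset.prod_mul_distrib]
    have e2 := Finset.prod_univ_sum (fun i : ι => (Finset.univ : Finset (Fin (n i))))
      (fun k a => T (g • k) k g (p (g • k)) a * T k (h⁻¹ • k) h a (r (h⁻¹ • k)))
    rw [Fintype.piFinset_univ] at e2
    rw [← e2]
    refine Eq.trans ?_ (Equiv.prod_comp (MulAction.toPerm h) _)
    refine Finset.prod_congr rfl fun j _ => ?_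
    change _ = ∑ a, T (g • h • j) (h • j) g (p (g • h • j)) a *
      T (h • j) (h⁻¹ • h • j) h a (r (h⁻¹ • h • j))
    rw [← Matrix.mul_apply, inv_smul_smul, hmul, mul_smul]

theorem tensorHom_trace {G ι : Type} [Group G] [Fintype ι] [DecidableEq ι] [MulAction G ι]
    (n : ι → ℕ) (T : ∀ i j : ι, G → Matrix (Fin (n i)) (Fin (n j)) ℂ)
    (hone : ∀ i, T i i 1 = 1)
    (hmul : ∀ (g h : G) (j : ι), T (g • h • j) (h • j) g * T (h • j) j h = T (g • h • j) j (g * h))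
    (g : G) (hg : ∀ j : ι, g • j = j) :
    (tensorHom n T hone hmul g).trace = ∏ j, (T j j g).trace := by
  have e2 := Finset.prod_univ_sum (fun i : ι => (Finset.univ : Finset (Fin (n i))))
      (fun k a => T k k g a a)
  rw [Fintype.piFinset_univ] at e2
  simp only [Matrix.trace, Matrix.diag_apply]
  rw [e2]
  refine Finset.sum_congr rfl fun p _ => ?_
  change ∏ j, T (g • j) j g (p (g • j)) (p j) = _
  refine Finset.prod_congr rfl fun j _ => ?_
  rw [hg j]

/-- A matrix-valued function on `G`, multiplicative on the normalizer of `S`, obtained from an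
extension of a character to the automorphism group. -/
theorem exists_normalizer_matrix {G : Type} [Group G] (S : Subgroup G)
    (χ : S → ℂ) (W : FDRep ℂ (MulAut S)) (hW : ∀ x : S, W.character (MulAut.conj x) = χ x) :
    ∃ (d : ℕ) (B : G → Matrix (Fin d) (Fin d) ℂ), B 1 = 1 ∧
      (∀ g h : G, (∀ x, x ∈ S ↔ g * x * g⁻¹ ∈ S) → (∀ x, x ∈ S ↔ h * x * h⁻¹ ∈ S) →
        B (g * h) = B g * B h) ∧
      (∀ x : S, (B x).trace = χ x) ∧
      (∀ c : G, (∀ x ∈ S, c * x * c⁻¹ = x) → B c = 1) := by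
  classical
  let b := Module.finBasis ℂ W
  let A : Subgroup.normalizer (S : Set G) →* Matrix _ _ ℂ :=
    (MonoidHomClass.toMonoidHom (LinearMap.toMatrixAlgEquiv b)).comp (W.ρ.comp S.normalizerMonoidHom)
  let B : G → Matrix _ _ ℂ := fun g =>
    if h : g ∈ Subgroup.normalizer (S : Set G) then A ⟨g, h⟩ else 0
  have hB : ∀ g (h : g ∈ Subgroup.normalizer (S : Set G)), B g = A ⟨g, h⟩ := fun g h => dif_pos h
  have hmem : ∀ g : G, (∀ x, x ∈ S ↔ g * x * g⁻¹ ∈ S) → g ∈ Subgroup.normalizer (S : Set G) := by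
    intro g hg
    rw [Subgroup.mem_normalizer_iff]
    exact hg
  refine ⟨_, B, ?_, ?_, ?_, ?_⟩
  · rw [hB 1 (one_mem _)]
    exact map_one A
  · intro g h hg hh
    rw [hB g (hmem g hg), hB h (hmem h hh), hB (g * h) (mul_mem (hmem g hg) (hmem h hh)), ← map_mul]
    rfl
  · intro x
    have hx : (x : G) ∈ Subgroup.normalizer (S : Set G) := Subgroup.le_normalizer x.2
    rw [hB _ hx, ← hW]
    have : S.normalizerMonoidHom ⟨x, hx⟩ = MulAut.conj x := by
      ext y
      simp
    change (LinearMap.toMatrixAlgEquiv b (W.ρ (S.normalizerMonoidHom ⟨x, hx⟩))).trace = _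
    rw [this, FDRep.character, LinearMap.trace_eq_matrix_trace ℂ b]
    rfl
  · intro c hc
    have hcm : c ∈ Subgroup.normalizer (S : Set G) := by
      apply hmem
      intro x
      constructor
      · intro hx
        rwa [hc x hx]
      · intro hx
        have h1 := hc _ hx
        have h2 : c * x * c⁻¹ = x := by
          have := congrArg (fun z => c⁻¹ * z * c) h1
          simpa [mul_assoc] using this
        rwa [h2] at hx
    rw [hB _ hcm]
    have : S.normalizerMonoidHom ⟨c, hcm⟩ = 1 := by
      ext y
      simp [hc y y.2]
    change LinearMap.toMatrixAlgEquiv b (W.ρ (S.normalizerMonoidHom ⟨c, hcm⟩)) = _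
    rw [this]
    simp

/-- Matrix with a change of index along an equality. -/
noncomputable def castMat {ι : Type} [DecidableEq ι] (d : ι → ℕ) (a b : ι)
    (A : Matrix (Fin (d b)) (Fin (d b)) ℂ) : Matrix (Fin (d a)) (Fin (d b)) ℂ :=
  if h : b = a then Eq.rec (motive := fun a _ => Matrix (Fin (d a)) (Fin (d b)) ℂ) A h else 0

theorem castMat_self {ι : Type} [DecidableEq ι] (d : ι → ℕ) (a : ι)
    (A : Matrix (Fin (d a)) (Fin (d a)) ℂ) : castMat d a a A = A := by
  simp [castMat]

theorem castMat_mul {ι G : Type} [DecidableEq ι] (d : ι → ℕ)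
    (B : ∀ i, G → Matrix (Fin (d i)) (Fin (d i)) ℂ) (a b c : ι) (hab : a = b) (hbc : b = c)
    (g h k : G) (hB : B c k = B c g * B c h) :
    castMat d a b (B b g) * castMat d b c (B c h) = castMat d a c (B c k) := by
  subst hab hbc
  simp [castMat_self, hB]

/-- Lemma (extension of characters of a product of simple groups): let `M ⊴ G` be an
internal direct product of non-abelian simple subgroups `Sᵢ` permuted by conjugation by
`G`. If `δᵢ ∈ Irr(Sᵢ)` satisfy `δᵢ^g = δⱼ` whenever `Sᵢ^{g⁻¹} = Sⱼ` and each `δᵢ` extends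
to `Aut(Sᵢ)`, then `δ = δ₁ × ⋯ × δₙ ∈ Irr(M)` extends to an irreducible character of `G`. -/
theorem stmt13 (G : Type) [Group G] [Fintype G]
    (ι : Type) [Fintype ι] [DecidableEq ι]
    (S : ι → Subgroup G) (M : Subgroup G) [M.Normal]
    (hsimple : ∀ i, IsSimpleGroup (S i))
    (hnonab : ∀ i, ∃ a b : (S i), a * b ≠ b * a)
    (f : ((i : ι) → (S i)) →* G)
    (hf : ∀ (i : ι) (x : (S i)), f (Pi.mulSingle i x) = (x : G))
    (hinj : Function.Injective f)
    (hrange : f.range = M)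
    (hperm : ∀ (g : G) (i : ι), ∃ j : ι, ∀ x : G, x ∈ S j ↔ g * x * g⁻¹ ∈ S i)
    (V : (i : ι) → FDRep ℂ (S i)) (hV : ∀ i, Simple (V i))
    (hcompat : ∀ (g : G) (i j : ι) (h : ∀ x : G, x ∈ S j ↔ g * x * g⁻¹ ∈ S i),
      ∀ x : (S j), (V i).character ⟨g * x * g⁻¹, (h x).1 x.2⟩ = (V j).character x)
    (hext : ∀ i : ι, ∃ W : FDRep ℂ (MulAut (S i)),
      ∀ x : (S i), W.character (MulAut.conj x) = (V i).character x) :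
    ∃ X : FDRep ℂ G, Simple X ∧
      ∀ y : (i : ι) → (S i), X.character (f y) = ∏ i, (V i).character (y i) := by
  classical
  have hSinj : Function.Injective S := by
    intro i j hij
    by_contra hne
    have := hsimple i
    obtain ⟨x, hx⟩ := exists_ne (1 : S i)
    have hxj : (x : G) ∈ S j := hij ▸ x.2
    have h1 : f (Pi.mulSingle i x) = f (Pi.mulSingle j ⟨x, hxj⟩) := by rw [hf, hf]
    have h2 := congrFun (hinj h1) i
    rw [Pi.mulSingle_eq_same, Pi.mulSingle_eq_of_ne hne] at h2
    exact hx h2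
  choose s hs using fun (g : G) (i : ι) => hperm g⁻¹ i
  letI act : MulAction G ι :=
    { smul := s
      one_smul := fun i => hSinj <| by
        ext x
        exact (hs 1 i x).trans (by simp)
      mul_smul := fun g h i => hSinj <| by
        ext x
        refine (hs (g * h) i x).trans (Iff.trans ?_ (hs g (s h i) x).symm)
        refine Iff.trans ?_ (hs h i _).symm
        simp [mul_assoc] }
  have hsm : ∀ (g : G) (i : ι) (x : G), x ∈ S (g • i) ↔ g⁻¹ * x * g ∈ S i := by
    intro g i x
    have := hs g i x
    rwa [inv_inv] at this
  have hconj : ∀ (u : G) (i j : ι), u • j = i → ∀ x, x ∈ S j ↔ u * x * u⁻¹ ∈ S i := by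
    rintro u i j rfl x
    rw [hsm]
    simp [mul_assoc]
  let rep : ι → ι := fun i => (Quotient.mk (MulAction.orbitRel G ι) i).out
  have hrep : ∀ (g : G) (i : ι), rep (g • i) = rep i := by
    intro g i
    have : Quotient.mk (MulAction.orbitRel G ι) (g • i) = Quotient.mk (MulAction.orbitRel G ι) i :=
      Quotient.sound ⟨g, rfl⟩
    simp only [rep, this]
  have hex : ∀ i, ∃ t : G, t • rep i = i := by
    intro i
    have h1 : (MulAction.orbitRel G ι) (rep i) i := Quotient.exact (Quotient.out_eq _)
    obtain ⟨t, ht⟩ := (MulAction.orbitRel G ι).symm h1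
    exact ⟨t, ht⟩
  choose t ht using hex
  have hti : ∀ i, (t i)⁻¹ • i = rep i := fun i => by rw [inv_smul_eq_iff, ht]
  choose W hW using hext
  choose d B hB1 hBmul hBtr hBc using
    fun i => exists_normalizer_matrix (S i) (V i).character (W i) (hW i)
  let T : ∀ i j : ι, G → Matrix (Fin (d (rep i))) (Fin (d (rep j))) ℂ := fun i j g =>
    castMat d (rep i) (rep j) (B (rep j) ((t i)⁻¹ * g * t j))
  have hone : ∀ i, T i i 1 = 1 := by
    intro i
    simp only [T, castMat_self]
    simp [hB1]
  have hmul : ∀ (g h : G) (j : ι),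
      T (g • h • j) (h • j) g * T (h • j) j h = T (g • h • j) j (g * h) := by
    intro g h j
    refine castMat_mul d B _ _ _ (hrep _ _) (hrep _ _) _ _ _ ?_
    rw [← hBmul]
    · congr 1
      group
    · refine hconj _ _ _ ?_
      conv_lhs => rw [← hrep h j]
      rw [mul_smul, mul_smul, ht, hti, hrep, hrep]
    · refine hconj _ _ _ ?_
      rw [mul_smul, mul_smul, ht, hti, hrep]
  let R := tensorHom (fun i => d (rep i)) T hone hmul
  let X : FDRep ℂ G := FDRep.of
    ((MonoidHomClass.toMonoidHom (Matrix.toLinAlgEquiv' (R := ℂ)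
      (n := ∀ i, Fin (d (rep i))))).comp R)
  have hdecomp : ∀ (y : (i : ι) → S i) (j : ι), ∃ c : G, f y = y j * c ∧
      ∀ x ∈ S j, c * x * c⁻¹ = x := by
    intro y j
    refine ⟨f (Function.update y j 1), ?_, ?_⟩
    · rw [← hf, ← map_mul]
      congr 1
      ext k
      by_cases hk : k = j
      · subst hk
        simp
      · simp [hk]
    · intro x hx
      have h1 : x = f (Pi.mulSingle j ⟨x, hx⟩) := by rw [hf]
      rw [h1, ← map_inv, ← map_mul, ← map_mul]
      congr 1
      ext k
      by_cases hk : k = j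
      · subst hk
        simp
      · simp [hk]
  have hfix : ∀ (y : (i : ι) → S i) (j : ι), f y • j = j := by
    intro y j
    obtain ⟨c, hc, hcx⟩ := hdecomp y j
    apply hSinj
    have hle : ∀ x ∈ S j, f y * x * (f y)⁻¹ ∈ S j := by
      intro x hx
      have : f y * x * (f y)⁻¹ = y j * (c * x * c⁻¹) * (y j : G)⁻¹ := by
        rw [hc]
        group
      rw [this, hcx x hx]
      exact mul_mem (mul_mem (y j).2 hx) (inv_mem (y j).2)
    have hle' : S (f y • j) ≤ S j := by
      intro x hx
      rw [hsm] at hx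
      have := hle _ hx
      simpa [mul_assoc] using this
    refine le_antisymm hle' ?_
    intro x hx
    obtain ⟨c', hc', hcx'⟩ := hdecomp y⁻¹ j
    rw [hsm]
    have h3 : (f y)⁻¹ * x * f y = (y⁻¹ j : S j) * (c' * x * c'⁻¹) * ((y⁻¹ j : S j) : G)⁻¹ := by
      have : (f y)⁻¹ = (y⁻¹ j : S j) * c' := by rw [← hc', map_inv]
      rw [this, show f y = ((f y)⁻¹)⁻¹ by simp, this]
      group
    rw [h3, hcx' x hx]
    exact mul_mem (mul_mem (y⁻¹ j).2 hx) (inv_mem (y⁻¹ j).2)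
  have hchar : ∀ y : (i : ι) → S i, X.character (f y) = ∏ i, (V i).character (y i) := by
    intro y
    have h1 : X.character (f y) = (R (f y)).trace := by
      change LinearMap.trace ℂ _ (Matrix.toLin' (R (f y))) = _
      rw [Matrix.trace_toLin'_eq]
    rw [h1, tensorHom_trace _ _ _ _ _ (hfix y)]
    refine Finset.prod_congr rfl fun j _ => ?_
    simp only [T, castMat_self]
    obtain ⟨c, hc, hcx⟩ := hdecomp y j
    have hcj := hconj (t j) j (rep j) (ht j)
    have hz : (t j)⁻¹ * y j * t j ∈ S (rep j) := by
      rw [hcj]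
      simp [mul_assoc]
    have hc1 : ∀ x ∈ S (rep j), ((t j)⁻¹ * c * t j) * x * ((t j)⁻¹ * c * t j)⁻¹ = x := by
      intro x hx
      have := hcx _ ((hcj x).1 hx)
      calc _ = (t j)⁻¹ * (c * (t j * x * (t j)⁻¹) * c⁻¹) * t j := by group
        _ = x := by
          rw [this]
          group
    have hsplit : (t j)⁻¹ * f y * t j = ((t j)⁻¹ * y j * t j) * ((t j)⁻¹ * c * t j) := by
      rw [hc]
      group
    have hfixc : ((t j)⁻¹ * c * t j) • rep j = rep j := by
      have hcf : c = (f (Pi.mulSingle j (y j)))⁻¹ * f y := by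
        rw [hf, hc]
        group
      rw [mul_smul, mul_smul, ht, hcf, ← map_inv, ← map_mul, hfix, hti]
    have hfixy : ((t j)⁻¹ * y j * t j) • rep j = rep j := by
      rw [mul_smul, mul_smul, ht, ← hf, hfix, hti]
    rw [hsplit, hBmul _ _ _ (hconj _ _ _ hfixy) (hconj _ _ _ hfixc), hBc _ _ hc1, mul_one]
    have h4 := hBtr (rep j) ⟨_, hz⟩
    refine h4.trans ?_
    rw [← hcompat (t j) j (rep j) hcj]
    congr 1
    ext
    simp [mul_assoc]
  refine ⟨X, ?_, hchar⟩
  apply simple_of_res_simple f X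
  rw [FDRep.simple_iff_char_is_norm_one]
  have hres : ∀ y, FDRep.character ((Action.res _ f).obj X : FDRep ℂ ((i : ι) → S i)) y =
      ∏ i, (V i).character (y i) := hchar
  simp only [hres, ← Finset.prod_mul_distrib, Pi.inv_apply]
  have e2 := Finset.prod_univ_sum (fun i : ι => (Finset.univ : Finset (S i)))
      (fun i x => (V i).character x * (V i).character x⁻¹)
  rw [Fintype.piFinset_univ] at e2
  rw [← e2, Nat.card_pi, Nat.cast_prod]
  refine Finset.prod_congr rfl fun i _ => ?_
  exact (FDRep.simple_iff_char_is_norm_one _).1 (hV i)
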